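/- arXiv:1703.04661 — 6 statements merged into one kernel-verified Lean document; each statement's English description precedes it below -/
import Mathlib

section
/- Let p ≥ 2 be an integer and let π : S_p° → ℝ be a function satisfying the functional equation π(θ) = π(g_c(θ)) · (∏_{i=1}^p c_i) / (∑_{i=1}^p c_i θ_i)^p for every θ ∈ S_p° and every vector c ∈ ℝ^p with all entries positive. Then there exists a constant K ∈ ℝ (namely K = π(1/p, …, 1/p) · p^{−p}) such that π(θ) = K / ∏_{i=1}^p θ_i for all θ ∈ S_p°. -/
open Finset

/-- Any solution `π` of the simplex functional equation
`π(θ) = π(g_c(θ)) · (∏ c_i) / (∑ c_i θ_i)^p` on the open probability simplex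
is of the form `K / ∏ θ_i` with `K = π(1/p,…,1/p) · p^{-p}`. -/
theorem functional_equation_unique_solution
    (p : ℕ) (hp : 2 ≤ p) (π : (Fin p → ℝ) → ℝ)
    (hfe : ∀ θ : Fin p → ℝ, (∀ i, 0 < θ i) → (∑ i, θ i) = 1 →
      ∀ c : Fin p → ℝ, (∀ i, 0 < c i) →
        π θ = π (fun i => c i * θ i / ∑ j, c j * θ j) *
          (∏ i, c i) / (∑ i, c i * θ i) ^ p) :
    ∃ K : ℝ, K = π (fun _ => (p : ℝ)⁻¹) * ((p : ℝ) ^ p)⁻¹ ∧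
      ∀ θ : Fin p → ℝ, (∀ i, 0 < θ i) → (∑ i, θ i) = 1 →
        π θ = K / ∏ i, θ i := by
  refine ⟨_, rfl, fun θ hpos hsum => ?_⟩
  have hone : ∀ i, (θ i)⁻¹ * θ i = 1 := fun i => inv_mul_cancel₀ (hpos i).ne'
  have h := hfe θ hpos hsum (fun i => (θ i)⁻¹) fun i => inv_pos.mpr (hpos i)
  simp only [hone, sum_const, card_univ, Fintype.card_fin, nsmul_eq_mul, mul_one, one_div,
    prod_inv_distrib] at h
  rw [h]
  ring
end

section
/- (Hyers–Ulam–Rassias stability) Let p ≥ 2 be an integer, δ > 0, and let π : S_p° → ℝ satisfy |π(θ) − π(g_c(θ)) · (∏_{i=1}^p c_i) / (∑_{i=1}^p c_i θ_i)^p| < δ for every θ ∈ S_p° and every vector c ∈ ℝ^p with all entries positive. Then, defining π̂(θ) = π(1/p, …, 1/p) · p^{−p} / ∏_{i=1}^p θ_i, one has |π(θ) − π̂(θ)| < δ · e^{1/e} / ∏_{i=1}^p θ_i for every θ ∈ S_p°. -/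
open Finset

/-- Hyers–Ulam–Rassias stability of the simplex functional equation:
an approximate solution is within `δ · e^{1/e} / ∏ θ_i` of the exact solution
`π̂(θ) = π(1/p,…,1/p) · p^{-p} / ∏ θ_i`. -/
theorem functional_equation_stability
    (p : ℕ) (hp : 2 ≤ p) (δ : ℝ) (hδ : 0 < δ) (π : (Fin p → ℝ) → ℝ)
    (happrox : ∀ θ : Fin p → ℝ, (∀ i, 0 < θ i) → (∑ i, θ i) = 1 →
      ∀ c : Fin p → ℝ, (∀ i, 0 < c i) →
        |π θ - π (fun i => c i * θ i / ∑ j, c j * θ j) *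
          (∏ i, c i) / (∑ i, c i * θ i) ^ p| < δ) :
    ∀ θ : Fin p → ℝ, (∀ i, 0 < θ i) → (∑ i, θ i) = 1 →
      |π θ - π (fun _ => (p : ℝ)⁻¹) * ((p : ℝ) ^ p)⁻¹ / ∏ i, θ i| <
        δ * Real.exp (1 / Real.exp 1) / ∏ i, θ i := by
  intro θ hθ hsum
  have hprod : 0 < ∏ i, θ i := Finset.prod_pos fun i _ => hθ i
  have hle : ∏ i, θ i ≤ 1 := Finset.prod_le_one (fun i _ => (hθ i).le) fun i _ =>
    hsum ▸ Finset.single_le_sum (f := θ) (fun j _ => (hθ j).le) (Finset.mem_univ i)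
  have key := happrox θ hθ hsum (fun i => (θ i)⁻¹) fun i => inv_pos.mpr (hθ i)
  have hone : ∀ i, (θ i)⁻¹ * θ i = 1 := fun i => inv_mul_cancel₀ (hθ i).ne'
  simp only [hone, Finset.sum_const, Finset.card_univ, Fintype.card_fin, nsmul_eq_mul, mul_one,
    one_div, Finset.prod_inv_distrib] at key
  have hrw : π (fun _ => (p : ℝ)⁻¹) * ((p : ℝ) ^ p)⁻¹ / ∏ i, θ i =
      π (fun _ => (p : ℝ)⁻¹) * (∏ i, θ i)⁻¹ / (p : ℝ) ^ p := by
    simp only [div_eq_mul_inv]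
    ring
  rw [hrw]
  refine key.trans_le ?_
  rw [le_div_iff₀ hprod]
  have hexp : 1 ≤ Real.exp (1 / Real.exp 1) := Real.one_le_exp (by positivity)
  exact mul_le_mul_of_nonneg_left (hle.trans hexp) hδ.le
end

section
/- Let p ≥ 2 be an integer and c ∈ ℝ^p with all entries positive. Let D ⊆ ℝ^{p−1} be the open coordinate simplex D = {x ∈ ℝ^{p−1} : x_i > 0 for all i and ∑_{i=1}^{p−1} x_i < 1}, and for x ∈ D write θ(x) = (x_1, …, x_{p−1}, 1 − ∑_{i=1}^{p−1} x_i) ∈ ℝ^p. Define G : D → ℝ^{p−1} by G(x)_i = c_i x_i / (∑_{j=1}^{p−1} c_j x_j + c_p (1 − ∑_{j=1}^{p−1} x_j)) for i = 1, …, p−1. Then G maps D into D, G is differentiable on D, and the determinant of its derivative at each x ∈ D equals (∏_{i=1}^p c_i) / (∑_{i=1}^p c_i θ(x)_i)^p. -/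
open Finset

/-- The determinant of a diagonal matrix times a rank-one perturbation of the identity. -/
theorem det_diagonal_mul_one_add_vecMulVec {ι R : Type*} [Fintype ι] [DecidableEq ι] [CommRing R]
    (d u v : ι → R) :
    (Matrix.diagonal d * (1 + Matrix.vecMulVec u v)).det = (∏ i, d i) * (1 + ∑ i, v i * u i) := by
  rw [Matrix.det_mul, Matrix.det_diagonal, Matrix.vecMulVec_eq Unit,
    Matrix.det_one_add_replicateCol_mul_replicateRow, dotProduct]

/-- The derivative of a coordinatewise scaling divided by an affine function. -/
theorem hasFDerivAt_mul_div_affine {n : ℕ} (a b : Fin n → ℝ) (k : ℝ) (x : Fin n → ℝ)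
    (hx : k + ∑ j, b j * x j ≠ 0) :
    HasFDerivAt (fun y i => a i * y i / (k + ∑ j, b j * y j))
      (Matrix.toLin' (Matrix.diagonal (fun i => a i / (k + ∑ j, b j * x j)) *
        (1 + Matrix.vecMulVec (fun i => -(x i / (k + ∑ j, b j * x j))) b))).toContinuousLinearMap
      x := by
  rw [hasFDerivAt_pi']
  intro i
  have hcoord (j : Fin n) (r : ℝ) : HasFDerivAt (fun y : Fin n → ℝ => r * y j)
      (r • ContinuousLinearMap.proj (R := ℝ) (φ := fun _ : Fin n => ℝ) j) x :=
    (hasFDerivAt_apply j x).const_mul r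
  have hden := (HasFDerivAt.fun_sum (u := Finset.univ) fun j _ => hcoord j (b j)).const_add k
  simp only [div_eq_mul_inv]
  refine ((hcoord i (a i)).fun_mul ((hasDerivAt_inv hx).comp_hasFDerivAt x hden)).congr_fderiv ?_
  ext v
  simp [Matrix.mulVec_diagonal, Matrix.vecMulVec_mulVec,
    dotProduct]
  field_simp
  ring

/-- The coordinate representation `G` of the simplex renormalization
map (with `p = n + 1 ≥ 2`) maps the open coordinate simplex `D ⊆ ℝ^{p-1}` to itself,
is differentiable on `D`, and the determinant of its derivative at `x ∈ D` equals
`(∏ c_i) / (∑ c_i θ(x)_i)^p`, where `θ(x)` appends the coordinate `1 - ∑ x_i`. -/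
theorem simplex_map_jacobian_det
    (n : ℕ) (hn : 1 ≤ n) (c : Fin (n + 1) → ℝ) (hc : ∀ i, 0 < c i)
    (D : Set (Fin n → ℝ))
    (hD : D = {x : Fin n → ℝ | (∀ i, 0 < x i) ∧ (∑ i, x i) < 1})
    (θ : (Fin n → ℝ) → (Fin (n + 1) → ℝ))
    (hθ : ∀ x, θ x = Fin.snoc x (1 - ∑ i, x i))
    (G : (Fin n → ℝ) → (Fin n → ℝ))
    (hG : ∀ x, ∀ i : Fin n, G x i =
      c i.castSucc * x i /
        (∑ j : Fin n, c j.castSucc * x j + c (Fin.last n) * (1 - ∑ j, x j))) :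
    Set.MapsTo G D D ∧ DifferentiableOn ℝ G D ∧
      ∀ x ∈ D, (fderiv ℝ G x).det =
        (∏ i, c i) / (∑ i, c i * θ x i) ^ (n + 1) := by
  have hden (x : Fin n → ℝ) :
      ∑ j : Fin n, c j.castSucc * x j + c (Fin.last n) * (1 - ∑ j, x j) =
        c (Fin.last n) + ∑ j : Fin n, (c j.castSucc - c (Fin.last n)) * x j := by
    simp only [sub_mul, Finset.sum_sub_distrib, ← Finset.mul_sum]
    ring
  have hpos (x : Fin n → ℝ) (hx : x ∈ D) :
      0 < ∑ j : Fin n, c j.castSucc * x j + c (Fin.last n) * (1 - ∑ j, x j) := by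
    rw [hD] at hx
    exact add_pos_of_nonneg_of_pos
      (Finset.sum_nonneg fun j _ => (mul_pos (hc _) (hx.1 j)).le)
      (mul_pos (hc _) (sub_pos.2 hx.2))
  have hGfun : G = fun x i => c i.castSucc * x i /
      (c (Fin.last n) + ∑ j : Fin n, (c j.castSucc - c (Fin.last n)) * x j) := by
    funext x i
    rw [hG, hden]
  have hderiv (x : Fin n → ℝ) (hx : x ∈ D) :=
    hasFDerivAt_mul_div_affine (fun i : Fin n => c i.castSucc)
      (fun i => c i.castSucc - c (Fin.last n)) (c (Fin.last n)) x
      (hden x ▸ (hpos x hx).ne')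
  rw [← hGfun] at hderiv
  refine ⟨fun x hx => ?_, fun x hx => (hderiv x hx).differentiableAt.differentiableWithinAt,
    fun x hx => ?_⟩
  · have hS := hpos x hx
    rw [hD] at hx ⊢
    refine ⟨fun i => ?_, ?_⟩
    · rw [hG]
      exact div_pos (mul_pos (hc _) (hx.1 i)) hS
    · simp only [hG]
      rw [← Finset.sum_div, div_lt_one hS]
      exact lt_add_of_pos_right _ (mul_pos (hc _) (sub_pos.2 hx.2))
  · have hS := (hpos x hx).ne'
    have hθsum : ∑ i, c i * θ x i =
        ∑ j : Fin n, c j.castSucc * x j + c (Fin.last n) * (1 - ∑ j, x j) := by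
      simp [hθ, Fin.sum_univ_castSucc]
    rw [(hderiv x hx).fderiv, LinearMap.det_toContinuousLinearMap, LinearMap.det_toLin',
      det_diagonal_mul_one_add_vecMulVec, hθsum, hden, Fin.prod_univ_castSucc]
    rw [hden] at hS
    simp only [Finset.prod_div_distrib, Finset.prod_const, Finset.card_univ, Fintype.card_fin,
      mul_neg, Finset.sum_neg_distrib, ← mul_div_assoc, ← Finset.sum_div]
    field_simp
    ring
end

section
/- Let p ≥ 2 be an integer and c ∈ ℝ^p with all entries positive. Let D ⊆ ℝ^{p−1} be the open coordinate simplex D = {x ∈ ℝ^{p−1} : x_i > 0 for all i and ∑_{i=1}^{p−1} x_i < 1}, for x ∈ D write θ(x) = (x_1, …, x_{p−1}, 1 − ∑_{i=1}^{p−1} x_i), and define G : D → D by G(x)_i = c_i x_i / (∑_{j=1}^{p−1} c_j x_j + c_p (1 − ∑_{j=1}^{p−1} x_j)). Then for every measurable set A ⊆ D, the (p−1)-dimensional Lebesgue measure of the image G(A) equals ∫_A (∏_{i=1}^p c_i) / (∑_{i=1}^p c_i θ(x)_i)^p dx. -/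
open Finset MeasureTheory

/-- The Jacobian matrix at `x` of the projective map
`x ↦ (a i * x i / (d ⬝ᵥ x + b))_i`. -/
noncomputable def projectiveJacobian {ι : Type*} [Fintype ι] [DecidableEq ι]
    (a d : ι → ℝ) (b : ℝ) (x : ι → ℝ) : Matrix ι ι ℝ :=
  Matrix.diagonal (fun i => a i / (d ⬝ᵥ x + b)) *
    (1 + Matrix.replicateCol Unit (fun i => -(x i / (d ⬝ᵥ x + b))) *
      Matrix.replicateRow Unit d)

theorem det_projectiveJacobian {ι : Type*} [Fintype ι] [DecidableEq ι]
    (a d : ι → ℝ) (b : ℝ) (x : ι → ℝ) (hx : d ⬝ᵥ x + b ≠ 0) :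
    (projectiveJacobian a d b x).det =
      (∏ i, a i) * b / (d ⬝ᵥ x + b) ^ (Fintype.card ι + 1) := by
  have h : d ⬝ᵥ (fun i => -(x i / (d ⬝ᵥ x + b))) = -(d ⬝ᵥ x / (d ⬝ᵥ x + b)) := by
    simp only [dotProduct, mul_neg, Finset.sum_neg_distrib, Finset.sum_div, mul_div_assoc]
  rw [projectiveJacobian, Matrix.det_mul, Matrix.det_diagonal,
    Matrix.det_one_add_replicateCol_mul_replicateRow, h, Finset.prod_div_distrib,
    Finset.prod_const, Finset.card_univ]
  generalize d ⬝ᵥ x = s at hx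
  field_simp
  ring

theorem hasFDerivAt_projective {ι : Type*} [Fintype ι] [DecidableEq ι]
    (a d : ι → ℝ) (b : ℝ) (x : ι → ℝ) (hx : d ⬝ᵥ x + b ≠ 0) :
    HasFDerivAt (fun (y : ι → ℝ) i => a i * y i / (d ⬝ᵥ y + b))
      (LinearMap.toContinuousLinearMap (Matrix.toLin' (projectiveJacobian a d b x))) x := by
  rw [hasFDerivAt_pi']
  intro i
  have hcoord : ∀ j, HasFDerivAt (fun y : ι → ℝ => y j)
      (ContinuousLinearMap.proj (R := ℝ) (φ := fun _ : ι => ℝ) j) x :=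
    fun j => hasFDerivAt_apply j x
  have hden : HasFDerivAt (fun y : ι → ℝ => d ⬝ᵥ y + b)
      (∑ j, d j • ContinuousLinearMap.proj (R := ℝ) (φ := fun _ : ι => ℝ) j) x :=
    (HasFDerivAt.fun_sum fun j _ => (hcoord j).const_mul (d j)).add_const b
  have hinv := (hasDerivAt_inv hx).comp_hasFDerivAt x hden
  refine (((hcoord i).const_mul (a i)).mul hinv).congr_fderiv ?_
  ext v
  have hsum : (∑ j, d j • ContinuousLinearMap.proj (R := ℝ) (φ := fun _ : ι => ℝ) j) v =
      d ⬝ᵥ v := by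
    simp [dotProduct]
  have hmat : (projectiveJacobian a d b x).mulVec v i =
      a i / (d ⬝ᵥ x + b) * (v i + -(x i / (d ⬝ᵥ x + b)) * d ⬝ᵥ v) := by
    rw [projectiveJacobian, ← Matrix.mulVec_mulVec, Matrix.mulVec_diagonal, Matrix.add_mulVec,
      Matrix.one_mulVec, ← Matrix.mulVec_mulVec]
    simp [Matrix.mulVec, dotProduct, -Matrix.mulVec_mulVec]
  simp only [_root_.add_apply, _root_.smul_apply, Function.comp_apply,
    ContinuousLinearMap.comp_apply, ContinuousLinearMap.proj_apply,
    LinearMap.coe_toContinuousLinearMap', Matrix.toLin'_apply, hmat, hsum, smul_eq_mul]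
  field_simp
  ring

theorem injOn_projective {ι : Type*} [Fintype ι] (a d : ι → ℝ) (b : ℝ)
    (ha : ∀ i, a i ≠ 0) (hb : b ≠ 0) :
    Set.InjOn (fun (y : ι → ℝ) i => a i * y i / (d ⬝ᵥ y + b)) {y | d ⬝ᵥ y + b ≠ 0} := by
  intro x hx y hy hxy
  simp only [Set.mem_ofPred_eq] at hx hy
  have hcross : ∀ i, x i * (d ⬝ᵥ y + b) = y i * (d ⬝ᵥ x + b) := by
    intro i
    have h := congrFun hxy i
    simp only [div_eq_div_iff hx hy] at h
    exact mul_left_cancel₀ (ha i) (by linarith)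
  have hdot : d ⬝ᵥ x * (d ⬝ᵥ y + b) = d ⬝ᵥ y * (d ⬝ᵥ x + b) := by
    conv_lhs => rw [dotProduct, Finset.sum_mul]
    conv_rhs => rw [dotProduct, Finset.sum_mul]
    exact Finset.sum_congr rfl fun i _ => by rw [mul_assoc, hcross i, mul_assoc]
  have heq : d ⬝ᵥ x = d ⬝ᵥ y := mul_left_cancel₀ hb (by linarith)
  funext i
  have h := hcross i
  rw [heq] at h
  exact mul_right_cancel₀ hy h

/-- Change of variables for the coordinate representation `G` of the
simplex renormalization map (with `p = n + 1 ≥ 2`): for every measurable `A ⊆ D`,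
the Lebesgue measure of `G '' A` equals `∫_A (∏ c_i) / (∑ c_i θ(x)_i)^p dx`. -/
theorem simplex_map_image_measure
    (n : ℕ) (hn : 1 ≤ n) (c : Fin (n + 1) → ℝ) (hc : ∀ i, 0 < c i)
    (D : Set (Fin n → ℝ))
    (hD : D = {x : Fin n → ℝ | (∀ i, 0 < x i) ∧ (∑ i, x i) < 1})
    (θ : (Fin n → ℝ) → (Fin (n + 1) → ℝ))
    (hθ : ∀ x, θ x = Fin.snoc x (1 - ∑ i, x i))
    (G : (Fin n → ℝ) → (Fin n → ℝ))
    (hG : ∀ x, ∀ i : Fin n, G x i =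
      c i.castSucc * x i /
        (∑ j : Fin n, c j.castSucc * x j + c (Fin.last n) * (1 - ∑ j, x j))) :
    ∀ A : Set (Fin n → ℝ), A ⊆ D → MeasurableSet A →
      volume (G '' A) =
        ENNReal.ofReal
          (∫ x in A, (∏ i, c i) / (∑ i, c i * θ x i) ^ (n + 1)) := by
  intro A hAD hA
  set a : Fin n → ℝ := fun i => c i.castSucc
  set b : ℝ := c (Fin.last n)
  set d : Fin n → ℝ := fun i => a i - b
  have hb : 0 < b := hc _
  have hS : ∀ x : Fin n → ℝ, ∑ j, a j * x j + b * (1 - ∑ j, x j) = d ⬝ᵥ x + b := by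
    intro x
    simp only [d, dotProduct, sub_mul, Finset.sum_sub_distrib, ← Finset.mul_sum]
    ring
  have hG' : G = fun x i => a i * x i / (d ⬝ᵥ x + b) := by
    funext x i
    rw [hG, ← hS]
  have hθS : ∀ x, ∑ i, c i * θ x i = d ⬝ᵥ x + b := by
    intro x
    rw [← hS, Fin.sum_univ_castSucc]
    simp [hθ, a, b]
  have hlast : ∀ x ∈ A, 0 < b * (1 - ∑ j, x j) := by
    intro x hx
    have h := hAD hx
    rw [hD] at h
    exact mul_pos hb (sub_pos.2 h.2)
  have hterm : ∀ x ∈ A, ∀ i, 0 < a i * x i := by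
    intro x hx i
    have h := hAD hx
    rw [hD] at h
    exact mul_pos (hc _) (h.1 i)
  have hpos : ∀ x ∈ A, 0 < d ⬝ᵥ x + b := by
    intro x hx
    rw [← hS]
    exact add_pos_of_nonneg_of_pos (Finset.sum_nonneg fun i _ => (hterm x hx i).le) (hlast x hx)
  have hbounded : G '' A ⊆ Set.Icc 0 1 := by
    rintro _ ⟨x, hx, rfl⟩
    rw [hG']
    refine ⟨fun i => div_nonneg (hterm x hx i).le (hpos x hx).le,
      fun i => (div_le_one (hpos x hx)).2 ?_⟩
    have hle := Finset.single_le_sum (f := fun j => a j * x j)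
      (fun j _ => (hterm x hx j).le) (Finset.mem_univ i)
    rw [← hS]
    linarith [hlast x hx]
  have hvol : ∫⁻ x in A, ENNReal.ofReal ((∏ i, c i) / (d ⬝ᵥ x + b) ^ (n + 1)) =
      volume (G '' A) := by
    rw [hG', ← lintegral_abs_det_fderiv_eq_addHaar_image volume hA
      (fun x hx => (hasFDerivAt_projective a d b x (hpos x hx).ne').hasFDerivWithinAt)
      ((injOn_projective a d b (fun i => (hc _).ne') hb.ne').mono fun x hx => (hpos x hx).ne')]
    refine setLIntegral_congr_fun hA fun x hx => ?_
    have hnonneg : 0 ≤ (∏ i, c i) / (d ⬝ᵥ x + b) ^ (n + 1) :=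
      div_nonneg (Finset.prod_nonneg fun i _ => (hc i).le) (pow_nonneg (hpos x hx).le _)
    have hdet := det_projectiveJacobian a d b x (hpos x hx).ne'
    rw [Fintype.card_fin, ← Fin.prod_univ_castSucc c] at hdet
    rw [LinearMap.det_toContinuousLinearMap, LinearMap.det_toLin', hdet, abs_of_nonneg hnonneg]
  have hmeas : Measurable fun x : Fin n → ℝ => (∏ i, c i) / (d ⬝ᵥ x + b) ^ (n + 1) := by
    unfold dotProduct
    fun_prop
  simp only [hθS]
  rw [integral_eq_lintegral_of_nonneg_ae _ hmeas.aestronglyMeasurable, hvol, ENNReal.ofReal_toReal]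
  · exact ((measure_mono hbounded).trans_lt isCompact_Icc.measure_lt_top).ne
  · filter_upwards [ae_restrict_mem hA] with x hx
    exact div_nonneg (Finset.prod_nonneg fun i _ => (hc i).le) (pow_nonneg (hpos x hx).le _)
end

section
/- For every δ > 0 there exists ε₀ > 0 such that for every integer p ≥ 2, every F₀ ∈ ℝ^p with F_{0i} > 0 for all i and ∑_{i=1}^p F_{0i} = 1, and every ε ∈ (0, ε₀), one has Γ(ε) / ∏_{i=1}^p Γ(ε F_{0i}) < δ. That is, the Dirichlet normalizing constant C_ε can be made uniformly small simultaneously over all dimensions p ≥ 2 and all mean probability vectors F₀. -/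
open Finset

/-- The Dirichlet normalizing constant `C_ε = Γ(ε) / ∏ Γ(ε F₀ᵢ)` can be
made uniformly small simultaneously over all dimensions `p ≥ 2` and all mean
probability vectors `F₀`. -/
theorem dirichlet_normalizing_constant_uniformly_small :
    ∀ δ : ℝ, 0 < δ → ∃ ε₀ : ℝ, 0 < ε₀ ∧
      ∀ p : ℕ, 2 ≤ p →
        ∀ F₀ : Fin p → ℝ, (∀ i, 0 < F₀ i) → (∑ i, F₀ i) = 1 →
          ∀ ε : ℝ, 0 < ε → ε < ε₀ →
            Real.Gamma ε / ∏ i, Real.Gamma (ε * F₀ i) < δ := by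
  intro δ hδ
  obtain ⟨x, hx, hmin⟩ := Real.exists_isMinOn_Gamma_Ioi
  have hm : 0 < Real.Gamma x := Real.Gamma_pos_of_pos (by linarith [hx.1])
  refine ⟨min 1 (δ * Real.Gamma x), by positivity, ?_⟩
  intro p hp F hF hsum ε hε hlt
  obtain ⟨h1, h2⟩ := lt_min_iff.mp hlt
  have hΓ : 0 < Real.Gamma ε := Real.Gamma_pos_of_pos hε
  have hone : 1 ≤ Real.Gamma ε := by
    simpa using Real.Gamma_strictAntiOn_Ioc.antitoneOn ⟨hε, h1.le⟩
      (Set.right_mem_Ioc.mpr zero_lt_one) h1.le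
  have hfactor (i : Fin p) : Real.Gamma ε ≤ Real.Gamma (ε * F i) := by
    have hFi : F i ≤ 1 :=
      hsum ▸ single_le_sum (fun j _ => (hF j).le) (mem_univ i)
    have hle : ε * F i ≤ ε := mul_le_of_le_one_right hε.le hFi
    exact Real.Gamma_strictAntiOn_Ioc.antitoneOn
      ⟨mul_pos hε (hF i), hle.trans h1.le⟩ ⟨hε, h1.le⟩ hle
  have hprod : Real.Gamma ε ^ 2 ≤ ∏ i, Real.Gamma (ε * F i) :=
    calc Real.Gamma ε ^ 2 ≤ Real.Gamma ε ^ p := pow_le_pow_right₀ hone hp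
      _ = ∏ _i : Fin p, Real.Gamma ε := by simp
      _ ≤ _ := prod_le_prod (fun _ _ => hΓ.le) fun i _ => hfactor i
  have hbound : 1 < δ * Real.Gamma ε := by
    have hle : Real.Gamma x ≤ ε * Real.Gamma ε := by
      rw [← Real.Gamma_add_one hε.ne']
      exact hmin (Set.mem_Ioi.mpr (by linarith))
    have : ε * 1 < ε * (δ * Real.Gamma ε) := by
      nlinarith [mul_le_mul_of_nonneg_left hle hδ.le]
    exact lt_of_mul_lt_mul_left this hε.le
  rw [div_lt_iff₀ (lt_of_lt_of_le (by positivity) hprod)]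
  nlinarith [mul_le_mul_of_nonneg_left hprod hδ.le, mul_lt_mul_of_pos_right hbound hΓ]
end

section
/- For every δ > 0 there exists ε₀ > 0 such that for every integer p ≥ 2, every F₀ ∈ ℝ^p with F_{0i} > 0 for all i and ∑_{i=1}^p F_{0i} = 1, every ε ∈ (0, ε₀), and every θ ∈ S_p°, the Dirichlet density π^{(ε)}(θ) = C_ε ∏_{i=1}^p θ_i^{ε F_{0i} − 1} with C_ε = Γ(ε) / ∏_{i=1}^p Γ(ε F_{0i}) satisfies (∏_{i=1}^p θ_i) · |π^{(ε)}(θ) − C_ε / ∏_{i=1}^p θ_i| < δ. -/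
open Finset

theorem Real.one_half_le_Gamma_add_one {x : ℝ} (hx : 0 < x) (hx1 : x ≤ 1) :
    1 / 2 ≤ Real.Gamma (x + 1) := by
  have hconv := Real.convexOn_Gamma.2 (x := x + 1) (y := x + 1 + 1)
    (Set.mem_Ioi.2 (by positivity)) (Set.mem_Ioi.2 (by positivity)) hx.le (sub_nonneg.2 hx1)
    (add_sub_cancel _ _)
  simp only [smul_eq_mul] at hconv
  rw [show x * (x + 1) + (1 - x) * (x + 1 + 1) = 2 by ring, Real.Gamma_two,
    Real.Gamma_add_one (s := x + 1) (by positivity)] at hconv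
  have hpos : 0 < Real.Gamma (x + 1) := Real.Gamma_pos_of_pos (by positivity)
  nlinarith [mul_nonneg hpos.le (sq_nonneg (x - 1 / 2))]

/-- The normalizing constant of a Dirichlet distribution with at least two positive concentration
parameters of total mass `ε ≤ 1` is at most `1 / Γ(ε)`. -/
theorem Real.Gamma_sum_div_prod_Gamma_le {ι : Type*} [Fintype ι] [Nontrivial ι] {a : ι → ℝ}
    {ε : ℝ} (ha : ∀ i, 0 < a i) (hsum : ∑ i, a i = ε) (hε : ε ≤ 1) :
    Real.Gamma ε / ∏ i, Real.Gamma (a i) ≤ (Real.Gamma ε)⁻¹ := by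
  classical
  obtain ⟨i, j, hij⟩ := exists_pair_ne ι
  have hle (k : ι) : a k ≤ ε :=
    hsum ▸ single_le_sum (fun l _ ↦ (ha l).le) (mem_univ k)
  have hε0 : 0 < ε := (ha i).trans_le (hle i)
  have hpos : 0 < Real.Gamma ε := Real.Gamma_pos_of_pos hε0
  have hanti (k : ι) : Real.Gamma ε ≤ Real.Gamma (a k) :=
    Real.Gamma_strictAntiOn_Ioc.antitoneOn ⟨ha k, (hle k).trans hε⟩ ⟨hε0, hε⟩ (hle k)
  have hone : 1 ≤ Real.Gamma ε := by
    simpa using Real.Gamma_strictAntiOn_Ioc.antitoneOn ⟨hε0, hε⟩ ⟨one_pos, le_rfl⟩ hε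
  have hprod : Real.Gamma ε * Real.Gamma ε ≤ ∏ k, Real.Gamma (a k) := by
    rw [← mul_prod_erase univ _ (mem_univ i),
      ← mul_prod_erase (univ.erase i) _ (mem_erase.2 ⟨hij.symm, mem_univ j⟩)]
    have hrest : 1 ≤ ∏ k ∈ (univ.erase i).erase j, Real.Gamma (a k) :=
      one_le_prod fun k _ ↦ hone.trans (hanti k)
    exact mul_le_mul (hanti i) ((hanti j).trans (le_mul_of_one_le_right
      (hpos.trans_le (hanti j)).le hrest)) hpos.le (hpos.trans_le (hanti i)).le
  rw [div_le_iff₀ ((mul_pos hpos hpos).trans_le hprod), le_inv_mul_iff₀ hpos]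
  exact hprod

/-- Multiplying by `∏ θ i` turns the deviation of the unnormalized Dirichlet density from
`1 / ∏ θ i` into a quantity smaller than the normalizing constant. -/
theorem prod_mul_abs_mul_prod_rpow_sub_lt {ι : Type*} [Fintype ι] {a θ : ι → ℝ} {C : ℝ}
    (hC : 0 < C) (ha : ∀ i, 0 ≤ a i) (hθ : ∀ i, 0 < θ i) (hθ1 : ∀ i, θ i ≤ 1) :
    (∏ i, θ i) * |C * (∏ i, θ i ^ (a i - 1)) - C / ∏ i, θ i| < C := by
  have hP : 0 < ∏ i, θ i := prod_pos fun i _ ↦ hθ i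
  have hsplit : ∏ i, θ i ^ (a i - 1) = (∏ i, θ i ^ a i) / ∏ i, θ i := by
    rw [← prod_div_distrib]
    exact prod_congr rfl fun i _ ↦ Real.rpow_sub_one (hθ i).ne' _
  have hpos : 0 < ∏ i, θ i ^ a i := prod_pos fun i _ ↦ Real.rpow_pos_of_pos (hθ i) _
  have hle : ∏ i, θ i ^ a i ≤ 1 :=
    prod_le_one (fun i _ ↦ (Real.rpow_pos_of_pos (hθ i) _).le)
      fun i _ ↦ Real.rpow_le_one (hθ i).le (hθ1 i) (ha i)
  have heq : C * ((∏ i, θ i ^ a i) / ∏ i, θ i) - C / ∏ i, θ i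
      = -(C * (1 - ∏ i, θ i ^ a i) / ∏ i, θ i) := by ring
  rw [hsplit, heq, abs_neg,
    abs_of_nonneg (div_nonneg (mul_nonneg hC.le (sub_nonneg.2 hle)) hP.le),
    mul_div_cancel₀ _ hP.ne']
  nlinarith

/-- Uniform (over all dimensions `p ≥ 2` and mean vectors `F₀`)
finite-dimensional density form of the statement that `DP(ε, F₀)` is an
ε-invariant process. -/
theorem dp_eps_invariant_density_form :
    ∀ δ : ℝ, 0 < δ → ∃ ε₀ : ℝ, 0 < ε₀ ∧
      ∀ p : ℕ, 2 ≤ p →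
        ∀ F₀ : Fin p → ℝ, (∀ i, 0 < F₀ i) → (∑ i, F₀ i) = 1 →
          ∀ ε : ℝ, 0 < ε → ε < ε₀ →
            ∀ θ : Fin p → ℝ, (∀ i, 0 < θ i) → (∑ i, θ i) = 1 →
              (∏ i, θ i) *
                |(Real.Gamma ε / ∏ i, Real.Gamma (ε * F₀ i)) *
                    (∏ i, θ i ^ (ε * F₀ i - 1)) -
                  (Real.Gamma ε / ∏ i, Real.Gamma (ε * F₀ i)) / ∏ i, θ i| <
                δ := by
  intro δ hδ
  refine ⟨min 1 (δ / 2), by positivity, fun p hp F₀ hF hFsum ε hε hεlt θ hθ hθsum ↦ ?_⟩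
  have : Nontrivial (Fin p) := Fin.nontrivial_iff_two_le.2 hp
  obtain ⟨hε1, hεδ⟩ := lt_min_iff.1 hεlt
  have ha (i : Fin p) : 0 < ε * F₀ i := mul_pos hε (hF i)
  have hC : 0 < Real.Gamma ε / ∏ i, Real.Gamma (ε * F₀ i) :=
    div_pos (Real.Gamma_pos_of_pos hε) (prod_pos fun i _ ↦ Real.Gamma_pos_of_pos (ha i))
  have hθ1 (i : Fin p) : θ i ≤ 1 :=
    hθsum ▸ single_le_sum (fun j _ ↦ (hθ j).le) (mem_univ i)
  refine (prod_mul_abs_mul_prod_rpow_sub_lt hC (fun i ↦ (ha i).le) hθ hθ1).trans ?_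
  refine (Real.Gamma_sum_div_prod_Gamma_le ha
    (by rw [← mul_sum, hFsum, mul_one]) hε1.le).trans_lt ?_
  have hhalf : 1 / 2 ≤ ε * Real.Gamma ε := by
    rw [← Real.Gamma_add_one hε.ne']
    exact Real.one_half_le_Gamma_add_one hε hε1.le
  rw [inv_lt_iff_one_lt_mul₀ (Real.Gamma_pos_of_pos hε)]
  nlinarith [Real.Gamma_pos_of_pos hε]
end
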